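/- arXiv:2510.18682 — 3 statements merged into one kernel-verified Lean document; each statement's English description precedes it below -/
import Mathlib

section
/- Let C ⊆ ℝ^n be nonempty, convex and compact, let G : ℝ^n → ℝ^n be continuous and monotone, let ε > 0 and let B ⊆ C be nonempty. Define ψ^M_B(x) := sup{⟨G(y), x − y⟩ : y ∈ B}. Then the extended Mangasarian–Fromovitz constraint qualification holds for the problem min{f(x) : x ∈ C, ψ^M_B(x) ≤ ε}: for every x ∈ C, if λ ≥ 0 satisfies λ · max(ε − ψ^M_B(x), 0) = 0 and there exist g ∈ ∂ψ^M_B(x) and v ∈ N_C(x) with λg + v = 0, then λ = 0. -/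
open RealInnerProductSpace

/-- The approximated Minty gap function `ψ^M_B(x) = sup {⟪G y, x - y⟫ : y ∈ B}`. -/
noncomputable def psiMB {n : ℕ} (G : EuclideanSpace ℝ (Fin n) → EuclideanSpace ℝ (Fin n))
    (B : Set (EuclideanSpace ℝ (Fin n))) (x : EuclideanSpace ℝ (Fin n)) : ℝ :=
  sSup ((fun y => ⟪G y, x - y⟫) '' B)

/-- A weighted sum over pairs of a monotone operator is nonpositive. -/
theorem sum_sum_mul_inner_sub_nonpos {E ι : Type*} [NormedAddCommGroup E] [InnerProductSpace ℝ E]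
    [Fintype ι] {G : E → E} (hG : ∀ x y, 0 ≤ ⟪G x - G y, x - y⟫) (y : ι → E) (p : ι → ℝ)
    (hp : ∀ i, 0 ≤ p i) :
    ∑ i, ∑ j, p i * p j * ⟪G (y i), y j - y i⟫ ≤ 0 := by
  have hswap : ∑ i, ∑ j, p i * p j * ⟪G (y i), y j - y i⟫ =
      ∑ i, ∑ j, p i * p j * ⟪G (y j), y i - y j⟫ := by
    rw [Finset.sum_comm]
    exact Finset.sum_congr rfl fun i _ => Finset.sum_congr rfl fun j _ => by ring
  have hsum : ∑ i, ∑ j, p i * p j * ⟪G (y i), y j - y i⟫ +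
      ∑ i, ∑ j, p i * p j * ⟪G (y j), y i - y j⟫ ≤ 0 := by
    simp only [← Finset.sum_add_distrib]
    refine Finset.sum_nonpos fun i _ => Finset.sum_nonpos fun j _ => ?_
    have h := mul_nonneg (mul_nonneg (hp i) (hp j)) (hG (y i) (y j))
    simp only [inner_sub_left, inner_sub_right] at h ⊢
    linarith
  linarith

/-- Finite version of the existence of a solution to the Minty variational inequality. -/
theorem exists_forall_inner_sub_nonpos_of_finite {E ι : Type*} [NormedAddCommGroup E]
    [InnerProductSpace ℝ E] [Fintype ι] {C : Set E} (hne : C.Nonempty) (hconv : Convex ℝ C)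
    (hcomp : IsCompact C) {G : E → E} (hG : ∀ x y, 0 ≤ ⟪G x - G y, x - y⟫) (y : ι → E)
    (hy : ∀ i, y i ∈ C) :
    ∃ z ∈ C, ∀ i, ⟪G (y i), z - y i⟫ ≤ 0 := by
  classical
  by_contra! hcon
  let φ : E → ι → ℝ := fun z i => ⟪G (y i), z - y i⟫
  have hφ : Continuous φ := by fun_prop
  have hφconv : Convex ℝ (φ '' C) := by
    rintro _ ⟨a, ha, rfl⟩ _ ⟨b, hb, rfl⟩ s t hs ht hst
    refine ⟨s • a + t • b, hconv ha hb hs ht hst, funext fun i => ?_⟩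
    simp only [φ, Pi.add_apply, Pi.smul_apply, smul_eq_mul, inner_sub_right, inner_add_right,
      real_inner_smul_right]
    linear_combination (⟪G (y i), y i⟫) * hst
  have hdisj : Disjoint (φ '' C) (Set.Iic 0) := by
    rw [Set.disjoint_left]
    rintro _ ⟨z, hz, rfl⟩ hle
    obtain ⟨i, hi⟩ := hcon z hz
    exact absurd (hle i) (not_le.mpr hi)
  obtain ⟨f, u, v, hu, huv, hv⟩ := geometric_hahn_banach_compact_closed hφconv
    (hcomp.image hφ) (convex_Iic (0 : ι → ℝ)) isClosed_Iic hdisj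
  have hv0 : v < 0 := by simpa using hv 0 (Set.mem_Iic.mpr le_rfl)
  let p : ι → ℝ := fun i => -f (Pi.single i 1)
  have hp : ∀ i, 0 ≤ p i := by
    intro i
    by_contra! hi
    have h := hv (-(v / p i) • Pi.single i 1) (by
      rw [Set.mem_Iic]
      exact smul_nonpos_of_nonpos_of_nonneg
        (neg_nonpos.mpr (div_nonneg_of_nonpos hv0.le hi.le))
        (Pi.single_nonneg.mpr zero_le_one))
    have hval : f (-(v / p i) • Pi.single i 1) = v := by
      rw [map_smul, smul_eq_mul]
      have : f (Pi.single i 1) = -p i := by simp [p]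
      rw [this]
      field_simp [hi.ne]
    exact lt_irrefl _ (hval ▸ h)
  have hf : ∀ w, f w = -∑ i, p i * w i := by
    intro w
    conv_lhs => rw [pi_eq_sum_univ' w]
    simp [p, map_sum, mul_comm]
  have hpos : ∀ z ∈ C, 0 < ∑ i, p i * ⟪G (y i), z - y i⟫ := by
    intro z hz
    have h := hu _ ⟨z, hz, rfl⟩
    rw [hf] at h
    simp only [φ] at h
    linarith
  have hs : 0 < ∑ i, p i := by
    refine (Finset.sum_nonneg fun i _ => hp i).lt_of_ne fun h => ?_
    have h0 := (Finset.sum_eq_zero_iff_of_nonneg fun i _ => hp i).mp h.symm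
    obtain ⟨z, hz⟩ := hne
    have h1 := hpos z hz
    rw [Finset.sum_eq_zero fun i hi => by rw [h0 i hi, zero_mul]] at h1
    exact lt_irrefl _ h1
  have hz := hpos _ (hconv.centerMass_mem (t := Finset.univ) (fun i _ => hp i) hs
    fun i _ => hy i)
  have hexp : (∑ j, p j) * ∑ i, p i * ⟪G (y i), Finset.univ.centerMass p y - y i⟫ =
      ∑ i, ∑ j, p i * p j * ⟪G (y i), y j - y i⟫ := by
    rw [Finset.mul_sum]
    refine Finset.sum_congr rfl fun i _ => ?_
    have h : (∑ j, p j) • (Finset.univ.centerMass p y - y i) = ∑ j, p j • (y j - y i) := by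
      rw [Finset.centerMass, smul_sub, smul_inv_smul₀ hs.ne']
      simp only [smul_sub, Finset.sum_sub_distrib, Finset.sum_smul]
    rw [mul_left_comm, ← real_inner_smul_right, h, inner_sum, Finset.mul_sum]
    simp only [real_inner_smul_right, mul_assoc]
  exact absurd (hexp ▸ mul_pos hs hz) (not_lt.mpr (sum_sum_mul_inner_sub_nonpos hG y p hp))

/-- A monotone operator on a nonempty convex compact set admits a solution of the Minty
variational inequality. -/
theorem exists_forall_inner_sub_nonpos {E : Type*} [NormedAddCommGroup E]
    [InnerProductSpace ℝ E] {C : Set E} (hne : C.Nonempty) (hconv : Convex ℝ C)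
    (hcomp : IsCompact C) {G : E → E} (hG : ∀ x y, 0 ≤ ⟪G x - G y, x - y⟫) :
    ∃ z ∈ C, ∀ y ∈ C, ⟪G y, z - y⟫ ≤ 0 := by
  obtain ⟨z, hz, hzy⟩ := hcomp.inter_iInter_nonempty
    (fun y : C => {z | ⟪G y, z - y⟫ ≤ 0})
    (fun y => isClosed_le (by fun_prop) continuous_const) fun t => by
      obtain ⟨z, hz, h⟩ := exists_forall_inner_sub_nonpos_of_finite hne hconv hcomp hG
        (fun i : t => (i : E)) fun i => i.1.2
      exact ⟨z, hz, Set.mem_iInter₂.mpr fun y hy => h ⟨y, hy⟩⟩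
  exact ⟨z, hz, fun y hy => Set.mem_iInter.mp hzy ⟨y, hy⟩⟩

/-- The extended Mangasarian–Fromovitz constraint qualification holds for
the problem `min {f(x) : x ∈ C, ψ^M_B(x) ≤ ε}`: at every `x ∈ C`, if `λ ≥ 0` satisfies the
complementarity condition `λ ((ψ^M_B(x) − ε)⁻) = 0` and `0 ∈ λ ∂ψ^M_B(x) + N_C(x)`,
then `λ = 0`. -/
theorem eMFCQ_holds {n : ℕ} (C : Set (EuclideanSpace ℝ (Fin n)))
    (hne : C.Nonempty) (hconv : Convex ℝ C) (hcomp : IsCompact C)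
    (G : EuclideanSpace ℝ (Fin n) → EuclideanSpace ℝ (Fin n))
    (hGc : Continuous G)
    (hGm : ∀ x y : EuclideanSpace ℝ (Fin n), 0 ≤ ⟪G x - G y, x - y⟫)
    (ε : ℝ) (hε : 0 < ε)
    (B : Set (EuclideanSpace ℝ (Fin n))) (hBne : B.Nonempty) (hBsub : B ⊆ C)
    (x : EuclideanSpace ℝ (Fin n)) (hx : x ∈ C)
    (lam : ℝ) (hlam : 0 ≤ lam)
    (hcompl : lam * max (ε - psiMB G B x) 0 = 0)
    (g : EuclideanSpace ℝ (Fin n)) (hg : ∀ z, psiMB G B x + ⟪g, z - x⟫ ≤ psiMB G B z)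
    (v : EuclideanSpace ℝ (Fin n)) (hv : ∀ y ∈ C, ⟪v, y - x⟫ ≤ 0)
    (hsum : lam • g + v = 0) :
    lam = 0 := by
  by_contra hne0
  have hpos : 0 < lam := hlam.lt_of_ne' hne0
  have hψx : ε ≤ psiMB G B x := by
    have h := (mul_eq_zero.mp hcompl).resolve_left hne0
    linarith [max_eq_right_iff.mp h]
  obtain ⟨z, hz, hzy⟩ := exists_forall_inner_sub_nonpos hne hconv hcomp hGm
  have hψz : psiMB G B z ≤ 0 := by
    refine csSup_le (hBne.image _) ?_
    rintro _ ⟨y, hy, rfl⟩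
    exact hzy y (hBsub hy)
  have hgz : 0 ≤ ⟪g, z - x⟫ := by
    have h : lam * ⟪g, z - x⟫ + ⟪v, z - x⟫ = 0 := by
      rw [← real_inner_smul_left, ← inner_add_left, hsum, inner_zero_left]
    exact nonneg_of_mul_nonneg_right (by linarith [hv z hz]) hpos
  linarith [hg z]
end

section
/- Let C ⊆ ℝ^n be nonempty, convex and compact, let f : ℝ^n → ℝ be convex, let G : ℝ^n → ℝ^n be continuous and monotone, and let ε > 0. Then there exists ρ̄ > 0, independent of B, such that for every nonempty subset B ⊆ C and every ρ ≥ ρ̄, every minimizer x of f(·) + ρ · max(ψ^M_B(·) − ε, 0) over C satisfies ψ^M_B(x) ≤ ε and is an optimal solution of min{f(x) : x ∈ C, ψ^M_B(x) ≤ ε}; in other words, the exact penalty parameters ρ_B are uniformly bounded over all subsets B ⊆ C. -/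
open RealInnerProductSpace

/-- Minty's inequality for finitely many points: a monotone `G` admits a common solution in the
compact convex set `C` of the inequalities `⟪G y, x - y⟫ ≤ 0`, `y` ranging over a finite subset. -/
theorem exists_forall_inner_le_zero_of_finset {E : Type*} [NormedAddCommGroup E]
    [InnerProductSpace ℝ E] {C : Set E} (hne : C.Nonempty) (hconv : Convex ℝ C)
    (hcomp : IsCompact C) {G : E → E} (hGm : ∀ x y : E, 0 ≤ ⟪G x - G y, x - y⟫)
    (s : Finset C) : ∃ x ∈ C, ∀ y ∈ s, ⟪G y, x - y⟫ ≤ 0 := by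
  classical
  by_contra! hcon
  let Φ : E → (s → ℝ) := fun x i => ⟪G (i : C), x - (i : C)⟫
  have hΦc : Continuous Φ := by fun_prop
  have hKconv : Convex ℝ (Φ '' C) := by
    rintro _ ⟨x, hx, rfl⟩ _ ⟨x', hx', rfl⟩ a b ha hb hab
    refine ⟨a • x + b • x', hconv hx hx' ha hb hab, ?_⟩
    funext i
    simp only [Φ, Pi.add_apply, Pi.smul_apply, smul_eq_mul, inner_sub_right, inner_add_right,
      inner_smul_right]
    linear_combination ⟪G (i : C), ((i : C) : E)⟫ * hab
  have hdisj : Disjoint (Φ '' C) (Set.Iic 0) := by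
    rw [Set.disjoint_left]
    rintro _ ⟨x, hx, rfl⟩ hle
    obtain ⟨y, hy, hpos⟩ := hcon x hx
    exact absurd (hle ⟨y, hy⟩) (not_le.mpr hpos)
  obtain ⟨φ, u, v, hu, huv, hv⟩ := geometric_hahn_banach_compact_closed hKconv
    (hcomp.image hΦc) (convex_Iic 0) isClosed_Iic hdisj
  have hv0 : v < 0 := by simpa using hv 0 (Set.mem_Iic.mpr le_rfl)
  let w : s → ℝ := fun i => -φ (Pi.single i 1)
  have hφ : ∀ a : s → ℝ, φ a = -∑ i, w i * a i := by
    intro a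
    have h := LinearMap.pi_apply_eq_sum_univ (φ : (s → ℝ) →ₗ[ℝ] ℝ) a
    simp only [ContinuousLinearMap.coe_coe, smul_eq_mul] at h
    rw [h, ← Finset.sum_neg_distrib]
    refine Finset.sum_congr rfl fun i _ => ?_
    have : (Pi.single i 1 : s → ℝ) = fun j => if i = j then 1 else 0 := by
      funext j; simp [Pi.single_apply, eq_comm]
    simp only [w, this]
    ring
  have hw : ∀ i, 0 ≤ w i := by
    intro i
    by_contra! hi
    have hmem : (v / w i) • (-Pi.single i 1 : s → ℝ) ∈ Set.Iic (0 : s → ℝ) := by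
      have h1 : 0 ≤ v / w i := div_nonneg_of_nonpos hv0.le hi.le
      have h2 : (-Pi.single i 1 : s → ℝ) ≤ 0 := by
        rw [neg_nonpos, Pi.single_nonneg]
        exact zero_le_one
      exact smul_nonpos_of_nonneg_of_nonpos h1 h2
    have h := hv _ hmem
    rw [map_smul, map_neg, smul_eq_mul] at h
    change v < v / w i * w i at h
    rw [div_mul_cancel₀ _ hi.ne] at h
    exact lt_irrefl _ h
  have hpos : ∀ x ∈ C, 0 < ∑ i, w i * Φ x i := by
    intro x hx
    have h := hu _ ⟨x, hx, rfl⟩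
    rw [hφ] at h
    linarith
  have hS : 0 < ∑ i, w i := by
    refine (Finset.sum_nonneg fun i _ => hw i).lt_of_ne' fun h0 => ?_
    have hz := (Finset.sum_eq_zero_iff_of_nonneg fun i _ => hw i).mp h0
    obtain ⟨x, hx⟩ := hne
    have h := hpos x hx
    rw [Finset.sum_eq_zero fun i hi => by rw [hz i hi, zero_mul]] at h
    exact lt_irrefl _ h
  have hcenter := hpos (Finset.univ.centerMass w fun i => ((i : C) : E))
    (hconv.centerMass_mem (fun i _ => hw i) hS fun i _ => i.1.2)
  set m := Finset.univ.centerMass w fun i : s => ((i : C) : E) with hm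
  have hSm : (∑ j, w j) • m = ∑ j, w j • ((j : C) : E) := by
    rw [hm, Finset.centerMass, smul_inv_smul₀ hS.ne']
  have hexp : (∑ j, w j) * ∑ i, w i * Φ m i
      = ∑ i, ∑ j, w i * w j * ⟪G (i : C), ((j : C) : E) - (i : C)⟫ := by
    rw [Finset.mul_sum]
    refine Finset.sum_congr rfl fun i _ => ?_
    have h : (∑ j, w j) * Φ m i = ∑ j, w j * ⟪G (i : C), ((j : C) : E) - (i : C)⟫ := by
      simp only [Φ]
      rw [← inner_smul_right, smul_sub, hSm, Finset.sum_smul, ← Finset.sum_sub_distrib, inner_sum]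
      refine Finset.sum_congr rfl fun j _ => ?_
      rw [← smul_sub, inner_smul_right]
    rw [mul_left_comm, h, Finset.mul_sum]
    exact Finset.sum_congr rfl fun j _ => by ring
  have hsymm : 2 * ∑ i, ∑ j, w i * w j * ⟪G (i : C), ((j : C) : E) - (i : C)⟫
      = -∑ i, ∑ j, w i * w j * ⟪G (i : C) - G (j : C), ((i : C) : E) - (j : C)⟫ := by
    rw [two_mul]
    nth_rewrite 2 [Finset.sum_comm]
    rw [← Finset.sum_add_distrib, ← Finset.sum_neg_distrib]
    refine Finset.sum_congr rfl fun i _ => ?_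
    rw [← Finset.sum_add_distrib, ← Finset.sum_neg_distrib]
    refine Finset.sum_congr rfl fun j _ => ?_
    simp only [inner_sub_left, inner_sub_right]
    ring
  have hmono : 0 ≤ ∑ i, ∑ j, w i * w j * ⟪G (i : C) - G (j : C), ((i : C) : E) - (j : C)⟫ :=
    Finset.sum_nonneg fun i _ => Finset.sum_nonneg fun j _ =>
      mul_nonneg (mul_nonneg (hw i) (hw j)) (hGm _ _)
  have := mul_pos hS hcenter
  linarith

/-- A monotone map has a Minty solution on every nonempty compact convex set. -/
theorem exists_minty_solution {E : Type*} [NormedAddCommGroup E]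
    [InnerProductSpace ℝ E] {C : Set E} (hne : C.Nonempty) (hconv : Convex ℝ C)
    (hcomp : IsCompact C) {G : E → E} (hGm : ∀ x y : E, 0 ≤ ⟪G x - G y, x - y⟫) :
    ∃ x ∈ C, ∀ y ∈ C, ⟪G y, x - y⟫ ≤ 0 := by
  have h := hcomp.inter_iInter_nonempty (fun y : C => {x : E | ⟪G y, x - y⟫ ≤ 0})
    (fun y => isClosed_le (by fun_prop) continuous_const) fun s => by
      obtain ⟨x, hx, hxs⟩ := exists_forall_inner_le_zero_of_finset hne hconv hcomp hGm s
      exact ⟨x, hx, Set.mem_iInter₂.mpr hxs⟩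
  obtain ⟨x, hx, hxC⟩ := h
  exact ⟨x, hx, fun y hy => Set.mem_iInter.mp hxC ⟨y, hy⟩⟩

theorem inner_le_psiMB {n : ℕ} {C : Set (EuclideanSpace ℝ (Fin n))} (hcomp : IsCompact C)
    {G : EuclideanSpace ℝ (Fin n) → EuclideanSpace ℝ (Fin n)} (hGc : Continuous G)
    {B : Set (EuclideanSpace ℝ (Fin n))} (hBC : B ⊆ C) (x : EuclideanSpace ℝ (Fin n))
    {y : EuclideanSpace ℝ (Fin n)} (hy : y ∈ B) : ⟪G y, x - y⟫ ≤ psiMB G B x := by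
  have hcont : Continuous fun y => ⟪G y, x - y⟫ := by fun_prop
  exact le_csSup ((hcomp.image hcont).bddAbove.mono (Set.image_mono hBC)) ⟨y, hy, rfl⟩

theorem psiMB_le {n : ℕ} {G : EuclideanSpace ℝ (Fin n) → EuclideanSpace ℝ (Fin n)}
    {B : Set (EuclideanSpace ℝ (Fin n))} (hB : B.Nonempty) {x : EuclideanSpace ℝ (Fin n)} {c : ℝ}
    (h : ∀ y ∈ B, ⟪G y, x - y⟫ ≤ c) : psiMB G B x ≤ c :=
  csSup_le (hB.image _) (Set.forall_mem_image.mpr h)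

/-- Uniform exact penalization: there is `ρ̄ > 0`, independent of `B`,
such that for every nonempty `B ⊆ C` and every `ρ ≥ ρ̄`, every minimizer over `C` of
`f + ρ (ψ^M_B − ε)⁺` is feasible for and optimal for `min {f(x) : x ∈ C, ψ^M_B(x) ≤ ε}`. -/
theorem uniform_exact_penalty {n : ℕ} (C : Set (EuclideanSpace ℝ (Fin n)))
    (hne : C.Nonempty) (hconv : Convex ℝ C) (hcomp : IsCompact C)
    (f : EuclideanSpace ℝ (Fin n) → ℝ) (hf : ConvexOn ℝ Set.univ f)
    (G : EuclideanSpace ℝ (Fin n) → EuclideanSpace ℝ (Fin n))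
    (hGc : Continuous G)
    (hGm : ∀ x y : EuclideanSpace ℝ (Fin n), 0 ≤ ⟪G x - G y, x - y⟫)
    (ε : ℝ) (hε : 0 < ε) :
    ∃ ρbar > (0 : ℝ), ∀ B : Set (EuclideanSpace ℝ (Fin n)), B.Nonempty → B ⊆ C →
      ∀ ρ ≥ ρbar, ∀ x ∈ C,
        (∀ z ∈ C, f x + ρ * max (psiMB G B x - ε) 0 ≤ f z + ρ * max (psiMB G B z - ε) 0) →
          psiMB G B x ≤ ε ∧ ∀ z ∈ C, psiMB G B z ≤ ε → f x ≤ f z := by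
  obtain ⟨x₀, hx₀, hminty⟩ := exists_minty_solution hne hconv hcomp hGm
  have hfc : ContinuousOn f C := (hf.continuousOn isOpen_univ).mono (Set.subset_univ C)
  obtain ⟨c, hc, hmin⟩ := hcomp.exists_isMinOn hne hfc
  have hM : 0 < f x₀ - f c + 1 := by
    have : f c ≤ f x₀ := hmin hx₀
    linarith
  refine ⟨(f x₀ - f c + 1) / ε, div_pos hM hε, fun B hB hBC ρ hρ x hx hopt => ?_⟩
  have hfeas : psiMB G B x ≤ ε := by
    by_contra! hlt
    set p := psiMB G B x with hp
    have hp0 : 0 < p := hε.trans hlt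
    have hεp : 0 ≤ ε / p := (div_pos hε hp0).le
    have ht : 0 ≤ 1 - ε / p := by
      rw [sub_nonneg, div_le_one hp0]
      exact hlt.le
    have hsum : ε / p + (1 - ε / p) = 1 := by ring
    have hz : psiMB G B ((ε / p) • x + (1 - ε / p) • x₀) ≤ ε := by
      refine psiMB_le hB fun y hy => ?_
      have h1 : ⟪G y, x - y⟫ ≤ p := inner_le_psiMB hcomp hGc hBC x hy
      have h2 := hminty y (hBC hy)
      have hsplit : (ε / p) • x + (1 - ε / p) • x₀ - y
          = (ε / p) • (x - y) + (1 - ε / p) • (x₀ - y) := by module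
      rw [hsplit, inner_add_right, inner_smul_right, inner_smul_right]
      have h3 := mul_le_mul_of_nonneg_left h1 hεp
      rw [div_mul_cancel₀ _ hp0.ne'] at h3
      have h4 := mul_nonpos_of_nonneg_of_nonpos ht h2
      linarith
    have h := hopt _ (hconv hx hx₀ hεp ht hsum)
    have hfz := hf.2 (Set.mem_univ x) (Set.mem_univ x₀) hεp ht hsum
    rw [max_eq_right (sub_nonpos.mpr hz), mul_zero, add_zero,
      max_eq_left (sub_nonneg.mpr hlt.le)] at h
    simp only [smul_eq_mul] at hfz
    have hfx : f c ≤ f x := hmin hx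
    have hgap : ρ * (p - ε) ≤ (1 - ε / p) * (f x₀ - f x) := by linarith
    have hfactor : p - ε = (1 - ε / p) * p := by field_simp
    have htpos : 0 < 1 - ε / p := by
      rw [sub_pos, div_lt_one hp0]
      exact hlt
    rw [hfactor, mul_left_comm] at hgap
    have hρp := le_of_mul_le_mul_left hgap htpos
    have hρε : f x₀ - f c + 1 ≤ ρ * ε := (div_le_iff₀ hε).mp hρ
    have hρ0 : 0 ≤ ρ := (div_pos hM hε).le.trans hρ
    have := mul_le_mul_of_nonneg_left hlt.le hρ0
    linarith
  refine ⟨hfeas, fun z hz hzε => ?_⟩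
  simpa [max_eq_right (sub_nonpos.mpr hfeas), max_eq_right (sub_nonpos.mpr hzε)] using hopt z hz
end

section
/- Let C ⊆ ℝ^n be nonempty and compact, let f : ℝ^n → ℝ be continuous, let G : ℝ^n → ℝ^n be continuous, let ε > 0, ρ ≥ 0, and let B ⊆ C be nonempty. Define ψ^M_B(x) := sup{⟨G(y), x − y⟩ : y ∈ B} and ψ^M(x) := sup{⟨G(y), x − y⟩ : y ∈ C}. Suppose z minimizes f(·) + ρ · max(ψ^M_B(·) − ε, 0) over C and ψ^M_B(z) ≤ ε. Then f(z) ≤ f(x) for every x ∈ C with ψ^M(x) ≤ ε; consequently, if additionally ψ^M(z) ≤ ε, then z is an optimal solution of min{f(x) : x ∈ C, ψ^M(x) ≤ ε}. -/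
open RealInnerProductSpace

/-- Over a compact set, the Minty gap function dominates each of its approximations. -/
theorem psiMB_mono {n : ℕ} {G : EuclideanSpace ℝ (Fin n) → EuclideanSpace ℝ (Fin n)}
    (hG : Continuous G) {B C : Set (EuclideanSpace ℝ (Fin n))} (hC : IsCompact C)
    (hB : B.Nonempty) (hBC : B ⊆ C) (x : EuclideanSpace ℝ (Fin n)) :
    psiMB G B x ≤ psiMB G C x :=
  csSup_le_csSup (hC.bddAbove_image (by fun_prop)) (hB.image _) (Set.image_mono hBC)

/-- If `z` minimizes the penalized function `f + ρ (ψ^M_B − ε)⁺` over `C`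
and `ψ^M_B(z) ≤ ε`, then `f(z)` is a lower bound for `f` on `{x ∈ C : ψ^M(x) ≤ ε}`;
consequently, if moreover `ψ^M(z) ≤ ε`, then `z` solves `min {f(x) : x ∈ C, ψ^M(x) ≤ ε}`. -/
theorem penalized_minimizer_lower_bound {n : ℕ} (C : Set (EuclideanSpace ℝ (Fin n)))
    (hne : C.Nonempty) (hcomp : IsCompact C)
    (f : EuclideanSpace ℝ (Fin n) → ℝ) (hfc : Continuous f)
    (G : EuclideanSpace ℝ (Fin n) → EuclideanSpace ℝ (Fin n))
    (hGc : Continuous G)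
    (ε : ℝ) (hε : 0 < ε) (ρ : ℝ) (hρ : 0 ≤ ρ)
    (B : Set (EuclideanSpace ℝ (Fin n))) (hBne : B.Nonempty) (hBsub : B ⊆ C)
    (z : EuclideanSpace ℝ (Fin n)) (hz : z ∈ C)
    (hzmin : ∀ x ∈ C, f z + ρ * max (psiMB G B z - ε) 0 ≤ f x + ρ * max (psiMB G B x - ε) 0)
    (hzfeas : psiMB G B z ≤ ε) :
    (∀ x ∈ C, psiMB G C x ≤ ε → f z ≤ f x) ∧
      (psiMB G C z ≤ ε →
        z ∈ C ∧ psiMB G C z ≤ ε ∧ ∀ x ∈ C, psiMB G C x ≤ ε → f z ≤ f x) := by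
  have lower_bound : ∀ x ∈ C, psiMB G C x ≤ ε → f z ≤ f x := by
    intro x hx hxfeas
    have hxB : psiMB G B x ≤ ε := (psiMB_mono hGc hcomp hBne hBsub x).trans hxfeas
    simpa [max_eq_right (sub_nonpos.mpr hzfeas), max_eq_right (sub_nonpos.mpr hxB)]
      using hzmin x hx
  exact ⟨lower_bound, fun h => ⟨hz, h, lower_bound⟩⟩
end
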